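/- Let n be a positive integer and F a field which is of characteristic 0 or of characteristic p ≥ n. For every unipotent n×n matrix u over F, exp(log(u)) = u, where exp and log denote the truncated exponential and logarithm. Consequently, exp and log are mutually inverse bijections between the set of nilpotent n×n matrices over F and the set of unipotent n×n matrices over F. -/

import Mathlib

/-- The truncated exponential of an `n × n` matrix: `exp x = ∑_{i<n} x^i / i!`. -/
noncomputable def truncExp (n : ℕ) {F : Type*} [Field F]
    (x : Matrix (Fin n) (Fin n) F) : Matrix (Fin n) (Fin n) F :=
  ∑ i ∈ Finset.range n, ((Nat.factorial i : F)⁻¹) • x ^ i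

/-- The truncated logarithm of an `n × n` matrix: `log u = -∑_{i=1}^{n-1} (1-u)^i / i`. -/
noncomputable def truncLog (n : ℕ) {F : Type*} [Field F]
    (u : Matrix (Fin n) (Fin n) F) : Matrix (Fin n) (Fin n) F :=
  -∑ i ∈ Finset.Icc 1 (n - 1), ((i : F)⁻¹) • (1 - u) ^ i

namespace TruncatedExpLog

open Polynomial

/-- The exponential series truncated after degree `m`. -/
noncomputable def expPoly (F : Type*) [Field F] (m : ℕ) : F[X] :=
  ∑ i ∈ Finset.range (m + 1), C ((Nat.factorial i : F)⁻¹) * X ^ i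

/-- The series of `log (1 + X)` truncated after degree `m`. -/
noncomputable def logPoly (F : Type*) [Field F] (m : ℕ) : F[X] :=
  -∑ i ∈ Finset.range m, C (((i + 1 : ℕ) : F)⁻¹) * (-X) ^ (i + 1)

variable {F : Type*} [Field F] {m : ℕ}

lemma truncExp_eq_aeval (x : Matrix (Fin (m + 1)) (Fin (m + 1)) F) :
    truncExp (m + 1) x = aeval x (expPoly F m) := by
  simp [truncExp, expPoly, Algebra.smul_def]

lemma truncLog_eq_aeval (u : Matrix (Fin (m + 1)) (Fin (m + 1)) F) :
    truncLog (m + 1) u = aeval (u - 1) (logPoly F m) := by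
  have hIcc : Finset.Icc 1 (m + 1 - 1) = Finset.Ico (0 + 1) (m + 1) := by
    ext; simp
  simp only [truncLog, logPoly, hIcc, Finset.range_eq_Ico, map_neg, map_sum, map_mul, map_pow,
    aeval_X, aeval_C, neg_sub, Algebra.smul_def]
  rw [← Finset.sum_Ico_add']

lemma expPoly_succ (m : ℕ) :
    expPoly F (m + 1) = expPoly F m + C ((Nat.factorial (m + 1) : F)⁻¹) * X ^ (m + 1) :=
  Finset.sum_range_succ _ _

lemma logPoly_succ (m : ℕ) :
    logPoly F (m + 1) = logPoly F m - C (((m + 1 : ℕ) : F)⁻¹) * (-X) ^ (m + 1) := by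
  rw [logPoly, Finset.sum_range_succ, logPoly]
  ring

lemma X_dvd_expPoly_sub_one (m : ℕ) : (X : F[X]) ∣ expPoly F m - 1 := by
  rw [expPoly, Finset.sum_range_succ']
  simp only [Nat.factorial_zero, Nat.cast_one, inv_one, map_one, pow_zero, mul_one,
    add_sub_cancel_right]
  exact Finset.dvd_sum fun i _ => (dvd_pow_self X i.succ_ne_zero).mul_left _

lemma X_dvd_logPoly (m : ℕ) : (X : F[X]) ∣ logPoly F m := by
  rw [logPoly, dvd_neg]
  exact Finset.dvd_sum fun i _ =>
    ((dvd_neg.mpr (dvd_refl (X : F[X]))).trans (dvd_pow_self (-X) i.succ_ne_zero)).mul_left _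

lemma derivative_expPoly (hm : ∀ k, 0 < k → k ≤ m → (k : F) ≠ 0) :
    derivative (expPoly F m) + C ((Nat.factorial m : F)⁻¹) * X ^ m = expPoly F m := by
  induction m with
  | zero => simp [expPoly]
  | succ m ih =>
    have h1 : ((m + 1 : ℕ) : F) ≠ 0 := hm _ m.succ_pos le_rfl
    have h2 : ((Nat.factorial (m + 1) : F)⁻¹) * ((m + 1 : ℕ) : F) = (Nat.factorial m : F)⁻¹ := by
      rw [Nat.factorial_succ, Nat.cast_mul, mul_inv, mul_right_comm, inv_mul_cancel₀ h1, one_mul]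
    rw [expPoly_succ, derivative_add, derivative_C_mul_X_pow, h2, Nat.add_sub_cancel,
      ih fun k hk hkm => hm k hk (hkm.trans m.le_succ)]

lemma one_add_X_mul_derivative_logPoly (hm : ∀ k, 0 < k → k ≤ m → (k : F) ≠ 0) :
    (1 + X) * derivative (logPoly F m) = 1 - (-X) ^ m := by
  induction m with
  | zero => simp [logPoly]
  | succ m ih =>
    have h1 : ((m + 1 : ℕ) : F) ≠ 0 := hm _ m.succ_pos le_rfl
    have h2 : derivative (C (((m + 1 : ℕ) : F)⁻¹) * (-X) ^ (m + 1) : F[X]) = -(-X) ^ m := by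
      rw [derivative_C_mul, derivative_pow, derivative_neg, derivative_X, ← mul_assoc,
        ← mul_assoc, ← C_mul, Nat.add_sub_cancel, inv_mul_cancel₀ h1, C_1]
      ring
    rw [logPoly_succ, derivative_sub, h2, mul_sub,
      ih fun k hk hkm => hm k hk (hkm.trans m.le_succ)]
    ring

lemma X_pow_succ_dvd_of_derivative {k : ℕ} {g : F[X]} (hm : ∀ j, 0 < j → j ≤ k → (j : F) ≠ 0)
    (h0 : X ∣ g) (h : X ^ k ∣ derivative g) : X ^ (k + 1) ∣ g := by
  rw [X_pow_dvd_iff] at h ⊢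
  rintro (_ | d) hd
  · exact X_dvd_iff.mp h0
  · have := h d (by omega)
    rw [coeff_derivative] at this
    refine (mul_eq_zero.mp this).resolve_right ?_
    exact_mod_cast hm (d + 1) d.succ_pos (by omega)

/-- A solution `g` of `a * derivative g = c * g` modulo `X ^ m` with `g 0 = 0` and `a 0 ≠ 0` vanishes
modulo `X ^ (m + 1)`. -/
lemma X_pow_succ_dvd_of_mul_derivative_sub {a c g : F[X]}
    (hm : ∀ k, 0 < k → k ≤ m → (k : F) ≠ 0) (ha : X ∣ a - 1) (h0 : X ∣ g)
    (h : X ^ m ∣ a * derivative g - c * g) : X ^ (m + 1) ∣ g := by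
  obtain ⟨b, hb⟩ := ha
  have hcop : IsCoprime X a := ⟨-b, 1, by linear_combination hb⟩
  have key : ∀ k ≤ m, X ^ (k + 1) ∣ g := by
    intro k
    induction k with
    | zero => intro _; simpa using h0
    | succ k ih =>
      intro hk
      refine X_pow_succ_dvd_of_derivative (fun j hj hjk => hm j hj (hjk.trans hk)) h0 ?_
      refine (hcop.pow_left (m := k + 1)).dvd_of_dvd_mul_left ?_
      exact (dvd_sub_left ((ih (by omega)).mul_left c)).mp ((pow_dvd_pow X hk).trans h)
  exact key m le_rfl

lemma X_dvd_comp {p q : F[X]} (hp : X ∣ p) (hq : X ∣ q) : X ∣ p.comp q := by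
  obtain ⟨r, rfl⟩ := hp
  rw [mul_comp, X_comp]
  exact hq.mul_right _

lemma X_pow_succ_dvd_expPoly_comp_logPoly (hm : ∀ k, 0 < k → k ≤ m → (k : F) ≠ 0) :
    X ^ (m + 1) ∣ (expPoly F m).comp (logPoly F m) - (1 + X) := by
  have hE := congrArg (fun p => p.comp (logPoly F m)) (derivative_expPoly hm)
  simp only [add_comp, mul_comp, C_comp, pow_comp, X_comp] at hE
  have hL := one_add_X_mul_derivative_logPoly hm
  obtain ⟨q, hq⟩ := pow_dvd_pow_of_dvd (X_dvd_logPoly (F := F) m) m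
  rw [hq] at hE
  refine X_pow_succ_dvd_of_mul_derivative_sub (a := 1 + X) (c := 1) hm (by simp) ?_ ?_
  · have h := (X_dvd_comp (X_dvd_expPoly_sub_one m) (X_dvd_logPoly (F := F) m)).sub (dvd_refl X)
    simpa [sub_sub] using h
  · rw [derivative_sub, derivative_comp, derivative_add, derivative_one, derivative_X]
    refine ⟨-(C ((Nat.factorial m : F)⁻¹) * q) - (-1) ^ m * (derivative (expPoly F m)).comp
      (logPoly F m), ?_⟩
    have hX : (-X : F[X]) ^ m = (-1) ^ m * X ^ m := neg_pow X m
    rw [hX] at hL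
    linear_combination (derivative (expPoly F m)).comp (logPoly F m) * hL + hE

lemma X_pow_succ_dvd_logPoly_comp_expPoly (hm : ∀ k, 0 < k → k ≤ m → (k : F) ≠ 0) :
    X ^ (m + 1) ∣ (logPoly F m).comp (expPoly F m - 1) - X := by
  have hE := derivative_expPoly hm
  have hL := congrArg (fun p => p.comp (expPoly F m - 1)) (one_add_X_mul_derivative_logPoly hm)
  simp only [add_comp, sub_comp, mul_comp, one_comp, neg_comp, pow_comp, X_comp,
    add_sub_cancel] at hL
  obtain ⟨q, hq⟩ := pow_dvd_pow_of_dvd (dvd_neg.mpr (X_dvd_expPoly_sub_one (F := F) m)) m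
  rw [hq] at hL
  refine X_pow_succ_dvd_of_mul_derivative_sub (a := expPoly F m) (c := 0) hm
    (X_dvd_expPoly_sub_one m) ?_ ?_
  · exact (X_dvd_comp (X_dvd_logPoly m) (X_dvd_expPoly_sub_one m)).sub dvd_rfl
  · rw [derivative_sub, derivative_comp, derivative_sub, derivative_one, derivative_X]
    refine ⟨-(derivative (expPoly F m) * q) - C ((Nat.factorial m : F)⁻¹), ?_⟩
    linear_combination derivative (expPoly F m) * hL + hE

lemma pow_eq_zero_of_isNilpotent {n : ℕ} {x : Matrix (Fin n) (Fin n) F} (hx : IsNilpotent x) :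
    x ^ n = 0 := by
  have h := (Matrix.isNilpotent_charpoly_sub_pow_of_isNilpotent hx).eq_zero
  have h' := x.aeval_self_charpoly
  rw [sub_eq_zero.mp h] at h'
  simpa using h'

lemma aeval_eq_zero_of_X_pow_dvd {n : ℕ} {x : Matrix (Fin n) (Fin n) F} (hx : IsNilpotent x)
    {p : F[X]} (hp : X ^ n ∣ p) : aeval x p = 0 := by
  obtain ⟨q, rfl⟩ := hp
  simp [pow_eq_zero_of_isNilpotent hx]

lemma isNilpotent_aeval_of_X_dvd {A : Type*} [Ring A] [Algebra F A] {x : A} (hx : IsNilpotent x)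
    {p : F[X]} (hp : X ∣ p) : IsNilpotent (aeval x p) := by
  obtain ⟨q, rfl⟩ := hp
  rw [map_mul, aeval_X]
  refine Commute.isNilpotent_mul_right ?_ hx
  simpa using (Commute.all X q).map (aeval x)

lemma natCast_ne_zero_of_le (hchar : ringChar F = 0 ∨ m + 1 ≤ ringChar F) (k : ℕ) (hk : 0 < k)
    (hkm : k ≤ m) : (k : F) ≠ 0 := by
  rw [Ne, ringChar.spec]
  rcases hchar with h | h
  · rw [h, zero_dvd_iff]
    exact hk.ne'
  · exact Nat.not_dvd_of_pos_of_lt hk (by omega)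

end TruncatedExpLog

open TruncatedExpLog Polynomial in
/-- Over a field of characteristic `0` or `p ≥ n`: for every unipotent `n × n` matrix `u`,
`exp (log u) = u`; consequently `exp` and `log` are mutually inverse bijections
between the nilpotent and the unipotent `n × n` matrices. -/
theorem truncExp_truncLog (n : ℕ) (hn : 0 < n) (F : Type*) [Field F]
    (hchar : ringChar F = 0 ∨ n ≤ ringChar F) :
    (∀ u : Matrix (Fin n) (Fin n) F, IsNilpotent (u - 1) →
        truncExp n (truncLog n u) = u) ∧
      Set.BijOn (truncExp n) {x : Matrix (Fin n) (Fin n) F | IsNilpotent x}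
        {u : Matrix (Fin n) (Fin n) F | IsNilpotent (u - 1)} ∧
      Set.BijOn (truncLog n) {u : Matrix (Fin n) (Fin n) F | IsNilpotent (u - 1)}
        {x : Matrix (Fin n) (Fin n) F | IsNilpotent x} ∧
      Set.InvOn (truncLog n) (truncExp n) {x : Matrix (Fin n) (Fin n) F | IsNilpotent x}
        {u : Matrix (Fin n) (Fin n) F | IsNilpotent (u - 1)} := by
  obtain ⟨m, rfl⟩ : ∃ m, n = m + 1 := ⟨n - 1, by omega⟩
  have hm := natCast_ne_zero_of_le hchar
  have hexp : ∀ x : Matrix (Fin (m + 1)) (Fin (m + 1)) F, IsNilpotent x →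
      IsNilpotent (truncExp (m + 1) x - 1) := fun x hx => by
    simpa [truncExp_eq_aeval] using isNilpotent_aeval_of_X_dvd hx (X_dvd_expPoly_sub_one m)
  have hlog : ∀ u : Matrix (Fin (m + 1)) (Fin (m + 1)) F, IsNilpotent (u - 1) →
      IsNilpotent (truncLog (m + 1) u) := fun u hu => by
    simpa [truncLog_eq_aeval] using isNilpotent_aeval_of_X_dvd hu (X_dvd_logPoly m)
  have hexplog : ∀ u : Matrix (Fin (m + 1)) (Fin (m + 1)) F, IsNilpotent (u - 1) →
      truncExp (m + 1) (truncLog (m + 1) u) = u := fun u hu => by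
    have h := aeval_eq_zero_of_X_pow_dvd hu (X_pow_succ_dvd_expPoly_comp_logPoly hm)
    rw [map_sub, aeval_comp, ← truncLog_eq_aeval, ← truncExp_eq_aeval, sub_eq_zero] at h
    simpa using h
  have hlogexp : ∀ x : Matrix (Fin (m + 1)) (Fin (m + 1)) F, IsNilpotent x →
      truncLog (m + 1) (truncExp (m + 1) x) = x := fun x hx => by
    have h := aeval_eq_zero_of_X_pow_dvd hx (X_pow_succ_dvd_logPoly_comp_expPoly hm)
    rw [map_sub, aeval_comp, map_sub, map_one, ← truncExp_eq_aeval, ← truncLog_eq_aeval,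
      sub_eq_zero, aeval_X] at h
    exact h
  have hinv : Set.InvOn (truncLog (m + 1)) (truncExp (m + 1))
      {x : Matrix (Fin (m + 1)) (Fin (m + 1)) F | IsNilpotent x} {u | IsNilpotent (u - 1)} :=
    ⟨hlogexp, hexplog⟩
  exact ⟨hexplog, hinv.bijOn hexp hlog, hinv.symm.bijOn hlog hexp, hinv⟩
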